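/- arXiv:math/0304303 — 2 statements merged into one kernel-verified Lean document; each statement's English description precedes it below -/
import Mathlib

section
/- Let q₁, q₂ ∈ MvPolynomial (Fin 4) ℂ be homogeneous of degree 2 such that the ideal Ideal.span {q₁, q₂} is a radical ideal. Let A be a 2×2 matrix with entries in MvPolynomial (Fin 4) ℂ, each entry homogeneous of degree 1. Then the following are equivalent: (i) for every point x : Fin 4 → ℂ with (MvPolynomial.eval x) q₁ = 0 and (MvPolynomial.eval x) q₂ = 0, the complex 2×2 matrix obtained by evaluating the entries of A at x has rank ≤ 1; (ii) there exist λ, μ ∈ ℂ such that A.det = λ • q₁ + μ • q₂. -/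
namespace Matrix

theorem rank_lt_card_iff_det_eq_zero {K n : Type*} [Field K] [Fintype n] [DecidableEq n]
    (M : Matrix n n K) : M.rank < Fintype.card n ↔ M.det = 0 := by
  refine ⟨fun h => by_contra fun hdet => h.ne (rank_of_det_ne_zero hdet), fun hdet => ?_⟩
  refine lt_of_le_of_ne M.rank_le_card_width fun h => ?_
  have htop : LinearMap.range M.mulVecLin = ⊤ := by
    apply Submodule.eq_top_of_finrank_eq
    rw [Module.finrank_fintype_fun_eq_card]
    exact h
  have hunit : IsUnit M :=
    mulVec_surjective_iff_isUnit.1 (LinearMap.range_eq_top.1 htop)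
  exact ((isUnit_iff_isUnit_det M).1 hunit).ne_zero hdet

end Matrix

namespace MvPolynomial

theorem homogeneousComponent_mul_isHomogeneous {σ R : Type*} [CommSemiring R]
    {q : MvPolynomial σ R} {d : ℕ} (hq : q.IsHomogeneous d) (a : MvPolynomial σ R) :
    homogeneousComponent d (a * q) = coeff 0 a • q := by
  conv_lhs => rw [← sum_homogeneousComponent a, Finset.sum_mul, map_sum]
  rw [Finset.sum_eq_single 0]
  · rw [homogeneousComponent_zero, homogeneousComponent_C_mul,
      homogeneousComponent_eq_self hq, smul_eq_C_mul]
  · intro i _ hi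
    rw [homogeneousComponent_of_mem ((homogeneousComponent_isHomogeneous i a).mul hq),
      if_neg (by omega)]
  · simp

theorem mem_span_pair_iff_of_isHomogeneous {σ R : Type*} [CommRing R]
    {p q₁ q₂ : MvPolynomial σ R} {d : ℕ} (hp : p.IsHomogeneous d)
    (hq₁ : q₁.IsHomogeneous d) (hq₂ : q₂.IsHomogeneous d) :
    p ∈ Ideal.span {q₁, q₂} ↔ ∃ a b : R, p = a • q₁ + b • q₂ := by
  rw [Ideal.mem_span_pair]
  constructor
  · rintro ⟨a, b, rfl⟩
    refine ⟨coeff 0 a, coeff 0 b, ?_⟩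
    rw [← homogeneousComponent_mul_isHomogeneous hq₁,
      ← homogeneousComponent_mul_isHomogeneous hq₂, ← map_add, homogeneousComponent_eq_self hp]
  · rintro ⟨a, b, rfl⟩
    exact ⟨C a, C b, by simp only [smul_eq_C_mul]⟩

theorem mem_span_pair_iff_of_isRadical {σ K : Type*} [Finite σ] [Field K] [IsAlgClosed K]
    {p q₁ q₂ : MvPolynomial σ K} (hrad : (Ideal.span {q₁, q₂}).IsRadical) :
    p ∈ Ideal.span {q₁, q₂} ↔ ∀ x : σ → K, eval x q₁ = 0 → eval x q₂ = 0 → eval x p = 0 := by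
  conv_lhs => rw [← hrad.radical, ← vanishingIdeal_zeroLocus_eq_radical (K := K), zeroLocus_span]
  simp [mem_vanishingIdeal_iff, aeval_eq_eval]

end MvPolynomial

/-- A 2×2 matrix of linear forms has rank ≤ 1 everywhere on the curve
q₁ = q₂ = 0 in P³ iff its determinant is a constant linear combination of q₁, q₂. -/
theorem rank_le_one_on_curve_iff_det_in_pencil
    (q₁ q₂ : MvPolynomial (Fin 4) ℂ)
    (hq₁ : q₁.IsHomogeneous 2) (hq₂ : q₂.IsHomogeneous 2)
    (hrad : (Ideal.span {q₁, q₂} : Ideal (MvPolynomial (Fin 4) ℂ)).IsRadical)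
    (A : Matrix (Fin 2) (Fin 2) (MvPolynomial (Fin 4) ℂ))
    (hA : ∀ i j, (A i j).IsHomogeneous 1) :
    (∀ x : Fin 4 → ℂ, MvPolynomial.eval x q₁ = 0 → MvPolynomial.eval x q₂ = 0 →
        (Matrix.of fun i j => MvPolynomial.eval x (A i j)).rank ≤ 1) ↔
    ∃ lam mu : ℂ, A.det = lam • q₁ + mu • q₂ := by
  have hdet : A.det.IsHomogeneous 2 := by
    rw [Matrix.det_fin_two]
    exact ((hA 0 0).mul (hA 1 1)).sub ((hA 0 1).mul (hA 1 0))
  rw [← MvPolynomial.mem_span_pair_iff_of_isHomogeneous hdet hq₁ hq₂,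
    MvPolynomial.mem_span_pair_iff_of_isRadical hrad]
  refine forall₃_congr fun x _ _ => ?_
  rw [← Nat.lt_succ_iff, RingHom.map_det]
  exact Matrix.rank_lt_card_iff_det_eq_zero _
end

section
/- Let q₁, q₂, q₃ ∈ MvPolynomial (Fin 6) ℂ be homogeneous of degree 2 such that the ideal Ideal.span {q₁, q₂, q₃} is a radical ideal. Let A be a 4×4 matrix with entries in MvPolynomial (Fin 6) ℂ such that Aᵀ = -A, every diagonal entry of A is 0, and each entry of A is homogeneous of degree 1. Then the following are equivalent: (i) for every point x : Fin 6 → ℂ with (MvPolynomial.eval x) q₁ = 0, (MvPolynomial.eval x) q₂ = 0 and (MvPolynomial.eval x) q₃ = 0, the complex 4×4 matrix obtained by evaluating the entries of A at x has rank ≤ 2; (ii) there exist λ₁, λ₂, λ₃ ∈ ℂ such that A 0 1 * A 2 3 - A 0 2 * A 1 3 + A 0 3 * A 1 2 = λ₁ • q₁ + λ₂ • q₂ + λ₃ • q₃. -/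
open Matrix

namespace Matrix

lemma rank_add_le {m n K : Type*} [Fintype n] [Finite m] [Field K] (M N : Matrix m n K) :
    (M + N).rank ≤ M.rank + N.rank := by
  rw [rank, mulVecLin_add]
  exact (Submodule.finrank_mono (LinearMap.range_add_le _ _)).trans
    (Submodule.finrank_add_le_finrank_add_finrank _ _)

/-- The Pfaffian of a `4 × 4` matrix, in terms of its entries above the diagonal. -/
def pfaffianFour {R : Type*} [CommRing R] (M : Matrix (Fin 4) (Fin 4) R) : R :=
  M 0 1 * M 2 3 - M 0 2 * M 1 3 + M 0 3 * M 1 2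

lemma det_eq_pfaffianFour_sq {R : Type*} [CommRing R] {M : Matrix (Fin 4) (Fin 4) R}
    (hM : Mᵀ = -M) (hdiag : ∀ i, M i i = 0) : M.det = M.pfaffianFour ^ 2 := by
  have h (i j : Fin 4) : M j i = -M i j := congrFun₂ hM i j
  simp only [det_succ_row_zero, Fin.sum_univ_succ, submatrix_apply, pfaffianFour]
  simp [Fin.succAbove, Fin.lt_def, hdiag, h 0 1, h 0 2, h 0 3, h 1 2, h 1 3, h 2 3]
  ring

/-- The three-term relations among the entries of an alternating matrix with zero Pfaffian. -/
lemma mul_eq_of_pfaffianFour_eq_zero {R : Type*} [CommRing R] {M : Matrix (Fin 4) (Fin 4) R}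
    (hM : Mᵀ = -M) (hdiag : ∀ i, M i i = 0) (hpf : M.pfaffianFour = 0) (k l i j : Fin 4) :
    M k l * M i j = M i k * M j l - M i l * M j k := by
  have h (i j : Fin 4) : M j i = -M i j := congrFun₂ hM i j
  rw [pfaffianFour] at hpf
  revert k l i j
  simp only [Fin.forall_fin_succ, Fin.forall_fin_zero, Fin.succ_zero_eq_one, Fin.reduceSucc,
    hdiag, h 0 1, h 0 2, h 0 3, h 1 2, h 1 3, h 2 3, and_true]
  refine ⟨?_, ?_, ?_, ?_⟩ <;> refine ⟨?_, ?_, ?_, ?_⟩ <;> refine ⟨?_, ?_, ?_, ?_⟩ <;>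
    refine ⟨?_, ?_, ?_, ?_⟩ <;>
    first | ring1 | linear_combination hpf | linear_combination -hpf

lemma rank_le_two_of_mul_eq {m K : Type*} [Fintype m] [Field K] {M : Matrix m m K}
    (h : ∀ k l i j, M k l * M i j = M i k * M j l - M i l * M j k) : M.rank ≤ 2 := by
  by_cases hM : M = 0
  · simp [hM]
  obtain ⟨k, l, hkl⟩ : ∃ k l, M k l ≠ 0 := by
    by_contra! h0
    exact hM (ext h0)
  have hdecomp : M = vecMulVec (fun i ↦ (M k l)⁻¹ * M i k) (fun j ↦ M j l) +
      vecMulVec (fun i ↦ -(M k l)⁻¹ * M i l) (fun j ↦ M j k) := by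
    ext i j
    apply mul_left_cancel₀ hkl
    simp only [add_apply, vecMulVec_apply]
    rw [h]
    field_simp
    ring
  rw [hdecomp]
  exact (rank_add_le _ _).trans (Nat.add_le_add (rank_vecMulVec_le _ _) (rank_vecMulVec_le _ _))

lemma rank_le_two_iff_pfaffianFour_eq_zero {K : Type*} [Field K] {M : Matrix (Fin 4) (Fin 4) K}
    (hM : Mᵀ = -M) (hdiag : ∀ i, M i i = 0) : M.rank ≤ 2 ↔ M.pfaffianFour = 0 := by
  refine ⟨fun hr ↦ ?_, fun hpf ↦
    rank_le_two_of_mul_eq (mul_eq_of_pfaffianFour_eq_zero hM hdiag hpf)⟩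
  by_contra hpf
  have hdet : M.det ≠ 0 := by
    rw [det_eq_pfaffianFour_sq hM hdiag]
    exact pow_ne_zero 2 hpf
  have := rank_of_det_ne_zero hdet
  simp only [Fintype.card_fin] at this
  omega

end Matrix

namespace MvPolynomial

variable {σ R : Type*} [CommRing R]

lemma homogeneousComponent_mul_of_isHomogeneous {q : MvPolynomial σ R} {d : ℕ}
    (hq : q.IsHomogeneous d) (a : MvPolynomial σ R) :
    homogeneousComponent d (a * q) = coeff 0 a • q := by
  let _ : GradedAlgebra (homogeneousSubmodule σ R) := gradedAlgebra
  have h := DirectSum.coe_decompose_mul_add_of_right_mem (homogeneousSubmodule σ R)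
    (a := a) (i := 0) (j := d) ((mem_homogeneousSubmodule d q).2 hq)
  rw [zero_add] at h
  rw [smul_eq_C_mul, ← homogeneousComponent_zero, ← decomposition.decompose'_apply (a * q),
    ← decomposition.decompose'_apply a]
  exact h

/-- A form of degree `d` in an ideal generated by forms of degree `d` is a linear combination of
the generators with constant coefficients. -/
lemma IsHomogeneous.mem_span_of_mem_ideal_span {s : Set (MvPolynomial σ R)} {d : ℕ}
    (hs : ∀ q ∈ s, q.IsHomogeneous d) {p : MvPolynomial σ R} (hp : p.IsHomogeneous d)
    (hmem : p ∈ Ideal.span s) : p ∈ Submodule.span R s := by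
  rw [← homogeneousComponent_eq_self hp]
  clear hp
  induction hmem using Submodule.closure_induction with
  | zero => simp
  | add x y _ _ hx hy => simpa using add_mem hx hy
  | smul_mem a q hq =>
    rw [smul_eq_mul, homogeneousComponent_mul_of_isHomogeneous (hs q hq)]
    exact Submodule.smul_mem _ _ (Submodule.subset_span hq)

end MvPolynomial

/-- A 4×4 alternating matrix of linear forms has rank ≤ 2 everywhere on the surface
q₁ = q₂ = q₃ = 0 in P⁵ iff its Pfaffian is a constant linear combination of q₁, q₂, q₃. -/
theorem rank_le_two_on_surface_iff_pfaffian_in_net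
    (q₁ q₂ q₃ : MvPolynomial (Fin 6) ℂ)
    (hq₁ : q₁.IsHomogeneous 2) (hq₂ : q₂.IsHomogeneous 2) (hq₃ : q₃.IsHomogeneous 2)
    (hrad : (Ideal.span {q₁, q₂, q₃} : Ideal (MvPolynomial (Fin 6) ℂ)).IsRadical)
    (A : Matrix (Fin 4) (Fin 4) (MvPolynomial (Fin 6) ℂ))
    (hAlt : Aᵀ = -A) (hDiag : ∀ i, A i i = 0)
    (hA : ∀ i j, (A i j).IsHomogeneous 1) :
    (∀ x : Fin 6 → ℂ,
        MvPolynomial.eval x q₁ = 0 → MvPolynomial.eval x q₂ = 0 →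
        MvPolynomial.eval x q₃ = 0 →
        (Matrix.of fun i j => MvPolynomial.eval x (A i j)).rank ≤ 2) ↔
    ∃ lam₁ lam₂ lam₃ : ℂ,
      A 0 1 * A 2 3 - A 0 2 * A 1 3 + A 0 3 * A 1 2 =
        lam₁ • q₁ + lam₂ • q₂ + lam₃ • q₃ := by
  have hpf_homog : A.pfaffianFour.IsHomogeneous 2 :=
    (((hA 0 1).mul (hA 2 3)).sub ((hA 0 2).mul (hA 1 3))).add ((hA 0 3).mul (hA 1 2))
  have hrank (x : Fin 6 → ℂ) : (Matrix.of fun i j => MvPolynomial.eval x (A i j)).rank ≤ 2 ↔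
      MvPolynomial.eval x A.pfaffianFour = 0 := by
    rw [rank_le_two_iff_pfaffianFour_eq_zero]
    · simp [pfaffianFour]
    · ext i j
      simpa using congrArg (MvPolynomial.eval x) (congrFun₂ hAlt i j)
    · simp [hDiag]
  change _ ↔ ∃ lam₁ lam₂ lam₃ : ℂ, A.pfaffianFour = _
  simp only [hrank]
  constructor
  · intro h
    have hmem : A.pfaffianFour ∈ Ideal.span {q₁, q₂, q₃} := by
      rw [← hrad.radical, ← MvPolynomial.vanishingIdeal_zeroLocus_eq_radical (K := ℂ),
        MvPolynomial.mem_vanishingIdeal_iff]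
      intro x hx
      simp only [MvPolynomial.zeroLocus_span, Set.mem_ofPred_eq, Set.mem_insert_iff,
        Set.mem_singleton_iff, forall_eq_or_imp, forall_eq] at hx
      exact h x hx.1 hx.2.1 hx.2.2
    have hspan := hpf_homog.mem_span_of_mem_ideal_span (by simp [hq₁, hq₂, hq₃]) hmem
    obtain ⟨a, b, c, habc⟩ := Submodule.mem_span_triple.1 hspan
    exact ⟨a, b, c, habc.symm⟩
  · rintro ⟨a, b, c, habc⟩ x h₁ h₂ h₃
    simp [habc, MvPolynomial.smul_eval, h₁, h₂, h₃]
end
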